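/- arXiv:2406.09632 — 2 statements merged into one kernel-verified Lean document; each statement's English description precedes it below -/
import Mathlib

section
/- Let p be a prime and a, b, c nonnegative integers with a ≤ p−1, b ≤ p−1, and c ≤ a+b. Then the polynomial f(a,b,c) has only simple roots in an algebraic closure of F_p, except possibly at 0 and 1; that is, for every α ∈ F̄_p with α ≠ 0 and α ≠ 1, the multiplicity of α as a root of f(a,b,c) (viewed in F̄_p[t]) is at most 1. -/
/-- `fabc p a b c = ∑_{i+j=c} C(a,i)·C(b,j)·t^i` in `F_p[t]`. -/
noncomputable def fabc (p a b c : ℕ) : Polynomial (ZMod p) :=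
  ∑ i ∈ Finset.range (c + 1),
    Polynomial.C ((a.choose i : ZMod p) * (b.choose (c - i) : ZMod p)) * Polynomial.X ^ i

open Polynomial in
/-- A polynomial of degree less than the characteristic which solves a second order linear
differential equation has at most simple roots outside the singular points of the equation. -/
theorem Polynomial.rootMultiplicity_le_one_of_ode {K : Type*} [Field K] {p : ℕ} [CharP K p]
    {f P Q R : K[X]} {α : K} (hp : f.natDegree < p)
    (hode : P * derivative (derivative f) + Q * derivative f + R * f = 0)
    (hP : P.eval α ≠ 0) : f.rootMultiplicity α ≤ 1 := by
  by_contra! hm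
  have hf : f ≠ 0 := by
    rintro rfl
    simp at hm
  obtain ⟨n, hn⟩ : ∃ n, f.rootMultiplicity α = n + 2 := ⟨_, (Nat.sub_add_cancel hm).symm⟩
  obtain ⟨g, hg, hroot⟩ := f.exists_eq_pow_rootMultiplicity_mul_and_not_dvd hf α
  rw [hn] at hg
  rw [dvd_iff_isRoot] at hroot
  have hlt : n + 2 < p := by
    classical
    have h := f.card_roots'
    have h' := f.roots.count_le_card α
    rw [count_roots, hn] at h'
    omega
  have hcast : ∀ k : ℕ, 0 < k → k < p → (k : K) ≠ 0 := fun k h0 hk h =>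
    Nat.not_dvd_of_pos_of_lt h0 hk ((CharP.cast_eq_zero_iff K p k).1 h)
  have h1 : ((n + 1 : ℕ) : K) ≠ 0 := hcast _ (by omega) (by omega)
  have h2 : ((n + 2 : ℕ) : K) ≠ 0 := hcast _ (by omega) hlt
  have hd : derivative f = (X - C α) ^ (n + 1) *
      (((n + 2 : ℕ) : K[X]) * g + (X - C α) * derivative g) := by
    rw [hg, derivative_mul, derivative_X_sub_C_pow]
    simp only [show n + 2 - 1 = n + 1 from rfl, map_natCast]
    ring
  have hdd : derivative (derivative f) = (X - C α) ^ n *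
      (((n + 1 : ℕ) : K[X]) * (((n + 2 : ℕ) : K[X]) * g + (X - C α) * derivative g) +
        (X - C α) *
          derivative (((n + 2 : ℕ) : K[X]) * g + (X - C α) * derivative g)) := by
    rw [hd, derivative_mul, derivative_X_sub_C_pow]
    simp only [Nat.add_sub_cancel, map_natCast]
    ring
  set u := ((n + 2 : ℕ) : K[X]) * g + (X - C α) * derivative g with hu
  have hfac : P * (((n + 1 : ℕ) : K[X]) * u + (X - C α) * derivative u) +
      Q * ((X - C α) * u) + R * ((X - C α) ^ 2 * g) = 0 := by
    refine (mul_eq_zero.1 ?_).resolve_left (pow_ne_zero n (X_sub_C_ne_zero α))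
    rw [hdd, hd] at hode
    linear_combination hode - R * hg
  have heval := congrArg (eval α) hfac
  simp only [hu, eval_add, eval_mul, eval_sub, eval_X, eval_C, eval_pow, eval_natCast, sub_self,
    zero_mul, mul_zero, add_zero, zero_pow two_ne_zero, eval_zero] at heval
  exact mul_ne_zero hP (mul_ne_zero h1 (mul_ne_zero h2 hroot)) heval

open Polynomial in
theorem coeff_fabc (p a b c i : ℕ) : (fabc p a b c).coeff i =
    if i ≤ c then (a.choose i : ZMod p) * (b.choose (c - i) : ZMod p) else 0 := by
  simp only [fabc, finsetSum_coeff, coeff_C_mul_X_pow, Finset.sum_ite_eq, Finset.mem_range,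
    Nat.lt_succ_iff]

theorem natDegree_fabc_le (p a b c : ℕ) : (fabc p a b c).natDegree ≤ a := by
  rw [Polynomial.natDegree_le_iff_coeff_eq_zero]
  intro i hi
  simp [coeff_fabc, Nat.choose_eq_zero_of_lt hi]

/-- The hypergeometric recurrence for the coefficients of `fabc`. -/
theorem coeff_fabc_succ (p a b c i : ℕ) :
    ((i : ZMod p) + 1) * (i + 1 + b - c) * (fabc p a b c).coeff (i + 1) =
      (a - i) * (c - i) * (fabc p a b c).coeff i := by
  have hchoose (n k : ℕ) :
      (n.choose (k + 1) : ZMod p) * (k + 1) = n.choose k * ((n : ZMod p) - k) := by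
    rcases le_or_gt k n with h | h
    · have := congrArg (Nat.cast : ℕ → ZMod p) (Nat.choose_succ_right_eq n k)
      push_cast [Nat.cast_sub h] at this
      exact this
    · simp [Nat.choose_eq_zero_of_lt h, Nat.choose_eq_zero_of_lt (Nat.lt_succ_of_lt h)]
  rw [coeff_fabc, coeff_fabc]
  rcases lt_trichotomy i c with h | rfl | h
  · obtain ⟨k, rfl⟩ := Nat.exists_eq_add_of_lt h
    rw [if_pos (by omega), if_pos (by omega), show i + k + 1 - (i + 1) = k by omega,
      show i + k + 1 - i = k + 1 by omega]
    have h1 := hchoose a i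
    have h2 := hchoose b k
    push_cast
    linear_combination (b.choose k * (b - k) : ZMod p) * h1 - (a.choose i * (a - i) : ZMod p) * h2
  · simp
  · simp [h.not_ge, (Nat.lt_succ_of_lt h).not_ge]

open Polynomial in
/-- The hypergeometric differential equation satisfied by `fabc`. -/
theorem fabc_ode (p a b c : ℕ) :
    (X * (1 - X)) * derivative (derivative (fabc p a b c)) +
      (C ((1 : ZMod p) + b - c) - C ((1 : ZMod p) - a - c) * X) * derivative (fabc p a b c) +
      C (-(a * c : ZMod p)) * fabc p a b c = 0 := by
  ext i
  have h := coeff_fabc_succ p a b c i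
  generalize fabc p a b c = f at h ⊢
  have e : (X * (1 - X)) * derivative (derivative f) +
      (C ((1 : ZMod p) + b - c) - C ((1 : ZMod p) - a - c) * X) * derivative f +
      C (-(a * c : ZMod p)) * f =
      derivative (derivative f) * X - derivative (derivative f) * X * X +
      C ((1 : ZMod p) + b - c) * derivative f - C ((1 : ZMod p) - a - c) * (derivative f * X) +
      C (-(a * c : ZMod p)) * f := by ring
  rw [e]
  rcases i with _ | _ | i <;>
    simp only [coeff_add, coeff_sub, coeff_C_mul, coeff_mul_X, coeff_mul_X_zero,
      coeff_derivative, coeff_zero] <;>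
    push_cast at h ⊢ <;> linear_combination h

/-- Proposition `f(a,b,c) is separable`: for `a, b ≤ p-1` and `c ≤ a+b`, the polynomial
`f(a,b,c)` has only simple roots in an algebraic closure of `F_p`, except possibly at `0`
and `1`: every `α ≠ 0, 1` has root multiplicity at most `1`. -/
theorem stmt_13 (p : ℕ) [Fact p.Prime] (a b c : ℕ)
    (ha : a ≤ p - 1) (hb : b ≤ p - 1) (hc : c ≤ a + b) :
    ∀ α : AlgebraicClosure (ZMod p), α ≠ 0 → α ≠ 1 →
      Polynomial.rootMultiplicity α
        ((fabc p a b c).map (algebraMap (ZMod p) (AlgebraicClosure (ZMod p)))) ≤ 1 := by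
  intro α h0 h1
  have : CharP (AlgebraicClosure (ZMod p)) p := charP_of_injective_algebraMap' (ZMod p) p
  have hp := (Fact.out : p.Prime).pos
  have hode := congrArg
    (Polynomial.map (algebraMap (ZMod p) (AlgebraicClosure (ZMod p)))) (fabc_ode p a b c)
  rw [Polynomial.map_add, Polynomial.map_add, Polynomial.map_mul,
    Polynomial.map_mul (p := Polynomial.C _ - _), Polynomial.map_mul (p := Polynomial.C _),
    ← Polynomial.derivative_map, ← Polynomial.derivative_map, Polynomial.map_zero] at hode
  refine Polynomial.rootMultiplicity_le_one_of_ode (p := p) ?_ hode ?_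
  · have := natDegree_fabc_le p a b c
    rw [Polynomial.natDegree_map]
    omega
  · simp [h0, sub_eq_zero, h1.symm]
end

section
/- Let p be a prime with p ≡ 1 (mod 7). Set φ₂ = f((2p−2)/7, (2p−2)/7, (p−1)/7) and φ₃ = f((3p−3)/7, (3p−3)/7, (5p−5)/7) in F_p[t] (the displayed quotients are integers since p ≡ 1 mod 7). Then there exists α ∈ F̄_p with α ≠ 0, 1 such that φ₂(α) = 0 and φ₃(α) ≠ 0, and there exists β ∈ F̄_p with β ≠ 0, 1 such that φ₃(β) = 0 and φ₂(β) ≠ 0. -/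
open Polynomial

theorem ZMod.natCast_choose_ne_zero {p : ℕ} [hp : Fact p.Prime] {n k : ℕ} (hk : k ≤ n)
    (hn : n < p) : (n.choose k : ZMod p) ≠ 0 := by
  rw [Ne, ZMod.natCast_eq_zero_iff]
  intro h
  have h1 : p ∣ n.factorial := by
    rw [← Nat.choose_mul_factorial_mul_factorial hk, mul_assoc]
    exact h.mul_right _
  exact absurd (hp.out.dvd_factorial.mp h1) (by lia)

theorem fabc_coeff (p a b c n : ℕ) : (fabc p a b c).coeff n =
    if n ≤ c then (a.choose n : ZMod p) * (b.choose (c - n) : ZMod p) else 0 := by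
  simp only [fabc, finsetSum_coeff, coeff_C_mul, coeff_X_pow]
  simp

theorem fabc_eval_one (p a b c : ℕ) : (fabc p a b c).eval 1 = ((a + b).choose c : ZMod p) := by
  rw [Nat.add_choose_eq, Finset.Nat.sum_antidiagonal_eq_sum_range_succ_mk]
  simp [fabc, eval_finsetSum]

theorem fabc_reflect (p N m : ℕ) (h : m ≤ N) :
    fabc p N N (2 * N - m) = X ^ (N - m) * fabc p N N m := by
  ext n
  rw [coeff_X_pow_mul', fabc_coeff, fabc_coeff]
  by_cases h1 : N - m ≤ n
  · by_cases h2 : n ≤ N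
    · rw [if_pos (by lia), if_pos h1, if_pos (by lia), mul_comm,
        Nat.choose_symm_of_eq_add (show N = n + (m - (n - (N - m))) by lia),
        Nat.choose_symm_of_eq_add (show N = 2 * N - m - n + (n - (N - m)) by lia)]
    · rw [if_pos h1, if_neg (show ¬ n - (N - m) ≤ m by lia), Nat.choose_eq_zero_of_lt (by lia)]
      simp
  · rw [if_neg h1, Nat.choose_eq_zero_of_lt (show N < 2 * N - m - n by lia)]
    simp

theorem fabc_natDegree {p N m : ℕ} [Fact p.Prime] (h : m ≤ N) (hN : N < p) :
    (fabc p N N m).natDegree = m := by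
  apply natDegree_eq_of_le_of_coeff_ne_zero
  · rw [natDegree_le_iff_coeff_eq_zero]
    intro n hn
    rw [fabc_coeff, if_neg (by lia)]
  · simpa [fabc_coeff] using ZMod.natCast_choose_ne_zero h hN

theorem fabc_coeff_succ (p : ℕ) {N m : ℕ} (h : m ≤ N) (i : ℕ) :
    ((i : ZMod p) + 1) * (i + 1 + N - m) * (fabc p N N m).coeff (i + 1) =
      (i - N) * (i - m) * (fabc p N N m).coeff i := by
  rw [fabc_coeff, fabc_coeff]
  rcases lt_trichotomy i m with hi | rfl | hi
  · obtain ⟨k, rfl⟩ := Nat.exists_eq_add_of_lt hi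
    obtain ⟨l, rfl⟩ := Nat.exists_eq_add_of_le h
    rw [if_pos (by lia), if_pos (by lia), show i + k + 1 - (i + 1) = k by lia,
      show i + k + 1 - i = k + 1 by lia]
    have h1 := congrArg (Nat.cast (R := ZMod p)) (Nat.choose_succ_right_eq (i + k + 1 + l) i)
    have h2 := congrArg (Nat.cast (R := ZMod p)) (Nat.choose_succ_right_eq (i + k + 1 + l) k)
    rw [show i + k + 1 + l - i = k + 1 + l by lia] at h1
    rw [show i + k + 1 + l - k = i + 1 + l by lia] at h2
    push_cast at h1 h2 ⊢
    linear_combination ((i : ZMod p) + 1 + l) * ((i + k + 1 + l).choose k : ZMod p) * h1 -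
      ((k : ZMod p) + 1 + l) * ((i + k + 1 + l).choose i : ZMod p) * h2
  · simp
  · rw [if_neg (by lia), if_neg (by lia)]
    simp

theorem fabc_hypergeometric (p : ℕ) {N m : ℕ} (h : m ≤ N) :
    X * (1 - X) * derivative (derivative (fabc p N N m)) +
      (C (1 + N - m : ZMod p) + C (N + m - 1 : ZMod p) * X) * derivative (fabc p N N m) +
      C (-(N * m) : ZMod p) * fabc p N N m = 0 := by
  rw [show ∀ f g h : (ZMod p)[X], ∀ a b c, X * (1 - X) * f + (C a + C b * X) * g + C c * h =
    X * f - X * (X * f) + C a * g + C b * (X * g) + C c * h by intros; ring]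
  ext i
  have hi := fabc_coeff_succ p h i
  rcases i with _ | _ | i <;>
    simp only [coeff_add, coeff_sub, coeff_C_mul, coeff_X_mul, coeff_X_mul_zero,
      coeff_derivative, coeff_zero] <;> push_cast at hi ⊢ <;> linear_combination hi

theorem Polynomial.roots_nodup_of_hypergeometric {K : Type*} [Field K] (p : ℕ) [CharP K p]
    {f : K[X]} (hdeg : f.natDegree < p) (h0 : f.eval 0 ≠ 0) (h1 : f.eval 1 ≠ 0) {A B : K[X]}
    (h : X * (1 - X) * derivative (derivative f) + A * derivative f + B * f = 0) :
    f.roots.Nodup := by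
  classical
  have hf : f ≠ 0 := by rintro rfl; simp at h0
  rw [Multiset.nodup_iff_count_le_one]
  intro a
  rw [count_roots]
  by_contra! hn
  obtain ⟨k, hk⟩ := Nat.exists_eq_add_of_le' (show 2 ≤ f.rootMultiplicity a from hn)
  have hkp : k + 2 < p := by
    have := (count_roots f (a := a)) ▸ Multiset.count_le_card a f.roots
    have := f.card_roots'
    lia
  obtain ⟨q, hq, hqa⟩ := f.exists_eq_pow_rootMultiplicity_mul_and_not_dvd hf a
  rw [hk] at hq
  rw [dvd_iff_isRoot, IsRoot.def] at hqa
  have ha : f.eval a = 0 := by simp [hq]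
  have key : (X - C a) ^ k * (X * (1 - X) * (C ((k : K) + 2) * C ((k : K) + 1) * q +
      2 * C ((k : K) + 2) * (X - C a) * derivative q +
      (X - C a) ^ 2 * derivative (derivative q)) +
      A * (C ((k : K) + 2) * (X - C a) * q + (X - C a) ^ 2 * derivative q) +
      B * (X - C a) ^ 2 * q) = 0 := by
    rw [← h, hq]
    simp only [derivative_mul, derivative_X_sub_C_pow, derivative_add, derivative_natCast,
      Nat.add_sub_cancel, show k + 2 - 1 = k + 1 by lia, C_add, C_1,
      map_natCast, map_ofNat]
    push_cast
    ring
  replace key := congrArg (eval a)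
    ((mul_eq_zero.mp key).resolve_left (pow_ne_zero _ (X_sub_C_ne_zero a)))
  have hcast : ∀ n : ℕ, 0 < n → n < p → (n : K) ≠ 0 := fun n hn hnp hz =>
    absurd (Nat.le_of_dvd hn ((CharP.cast_eq_zero_iff K p n).mp hz)) (by lia)
  have hk1 : (k : K) + 1 ≠ 0 := by exact_mod_cast hcast (k + 1) (by lia) (by lia)
  have hk2 : (k : K) + 2 ≠ 0 := by exact_mod_cast hcast (k + 2) (by lia) (by lia)
  have ha0 : a ≠ 0 := by rintro rfl; exact h0 ha
  have ha1 : 1 - a ≠ 0 := fun hz => h1 (by rwa [sub_eq_zero.mp hz])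
  simp [ha0, ha1, hk1, hk2, hqa] at key

theorem Polynomial.exists_root_not_root {K : Type*} [Field K] [IsAlgClosed K] {f g : K[X]}
    (hf : f.roots.Nodup) (hg : g ≠ 0) (hdeg : f.natDegree = g.natDegree)
    (hne : f.coeff 0 * g.coeff 1 ≠ f.coeff 1 * g.coeff 0) :
    ∃ a, f.eval a = 0 ∧ g.eval a ≠ 0 := by
  by_contra! hcon
  have hf0 : f ≠ 0 := by rintro rfl; simp at hne
  have hle : f.roots ≤ g.roots := (Multiset.le_iff_subset hf).mpr fun a ha =>
    (mem_roots hg).mpr (hcon a ((mem_roots hf0).mp ha))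
  obtain ⟨q, rfl⟩ := (IsAlgClosed.dvd_iff_roots_le_roots hf0 hg).mpr hle
  rw [natDegree_mul hf0 (right_ne_zero_of_mul hg)] at hdeg
  rw [eq_C_of_natDegree_eq_zero (show q.natDegree = 0 by lia), coeff_mul_C, coeff_mul_C] at hne
  exact hne (by ring)

theorem fabc_eval_zero_ne_zero {p N m : ℕ} [Fact p.Prime] (h : m ≤ N) (hN : N < p) :
    (fabc p N N m).eval 0 ≠ 0 := by
  rw [← coeff_zero_eq_eval_zero, fabc_coeff]
  simpa using ZMod.natCast_choose_ne_zero h hN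

theorem fabc_eval_one_ne_zero {p N m : ℕ} [Fact p.Prime] (h : m ≤ N) (hN : 2 * N < p) :
    (fabc p N N m).eval 1 ≠ 0 := by
  rw [fabc_eval_one]
  exact ZMod.natCast_choose_ne_zero (by lia) (by lia)

theorem aeval_fabc_zero_ne_zero {p N m : ℕ} [Fact p.Prime] (K : Type*) [Field K]
    [Algebra (ZMod p) K] (h : m ≤ N) (hN : N < p) : aeval (0 : K) (fabc p N N m) ≠ 0 := by
  have := (map_ne_zero (algebraMap (ZMod p) K)).mpr (fabc_eval_zero_ne_zero h hN)
  rwa [← aeval_algebraMap_apply_eq_algebraMap_eval, map_zero] at this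

theorem aeval_fabc_one_ne_zero {p N m : ℕ} [Fact p.Prime] (K : Type*) [Field K]
    [Algebra (ZMod p) K] (h : m ≤ N) (hN : 2 * N < p) : aeval (1 : K) (fabc p N N m) ≠ 0 := by
  have := (map_ne_zero (algebraMap (ZMod p) K)).mpr (fabc_eval_one_ne_zero h hN)
  rwa [← aeval_algebraMap_apply_eq_algebraMap_eval, map_one] at this

theorem fabc_map_roots_nodup {p N m : ℕ} [Fact p.Prime] (K : Type*) [Field K]
    [Algebra (ZMod p) K] (h : m ≤ N) (hN : 2 * N < p) :
    ((fabc p N N m).map (algebraMap (ZMod p) K)).roots.Nodup := by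
  have : CharP K p := charP_of_injective_algebraMap (algebraMap (ZMod p) K).injective p
  have hode := congrArg (Polynomial.map (algebraMap (ZMod p) K)) (fabc_hypergeometric p h)
  simp only [Polynomial.map_add, Polynomial.map_mul, Polynomial.map_sub, map_X,
    Polynomial.map_one, Polynomial.map_zero, ← derivative_map] at hode
  refine roots_nodup_of_hypergeometric p ?_ ?_ ?_ hode
  · rw [natDegree_map, fabc_natDegree h (by lia)]
    lia
  · rw [eval_map_algebraMap]
    exact aeval_fabc_zero_ne_zero K h (by lia)
  · rw [eval_map_algebraMap]
    exact aeval_fabc_one_ne_zero K h hN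

theorem exists_aeval_fabc_eq_zero_and_ne_zero {p N M m : ℕ} [Fact p.Prime] (K : Type*) [Field K]
    [IsAlgClosed K] [Algebra (ZMod p) K] (hN : m ≤ N) (hM : m ≤ M) (hNp : 2 * N < p)
    (hMp : M < p) (hne : (fabc p N N m).coeff 0 * (fabc p M M m).coeff 1 ≠
      (fabc p N N m).coeff 1 * (fabc p M M m).coeff 0) :
    ∃ a : K, a ≠ 0 ∧ a ≠ 1 ∧ aeval a (fabc p N N m) = 0 ∧ aeval a (fabc p M M m) ≠ 0 := by
  have hinj := (algebraMap (ZMod p) K).injective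
  obtain ⟨a, ha, ha'⟩ := exists_root_not_root (fabc_map_roots_nodup K hN hNp)
    (g := (fabc p M M m).map (algebraMap (ZMod p) K))
    (by
      rw [Ne, Polynomial.map_eq_zero]
      rintro hz
      simpa [hz] using fabc_eval_zero_ne_zero (p := p) hM hMp)
    (by rw [natDegree_map, natDegree_map, fabc_natDegree hN (by lia), fabc_natDegree hM hMp])
    (by
      simp only [coeff_map, ← map_mul]
      exact hinj.ne hne)
  rw [eval_map_algebraMap] at ha ha'
  refine ⟨a, ?_, ?_, ha, ha'⟩
  · rintro rfl
    exact aeval_fabc_zero_ne_zero K hN (by lia) ha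
  · rintro rfl
    exact aeval_fabc_one_ne_zero K hN hNp ha

theorem fabc_two_three_not_proportional {p m : ℕ} [hp : Fact p.Prime] (hpm : p = 7 * m + 1) :
    (fabc p (2 * m) (2 * m) m).coeff 0 * (fabc p (3 * m) (3 * m) m).coeff 1 ≠
      (fabc p (2 * m) (2 * m) m).coeff 1 * (fabc p (3 * m) (3 * m) m).coeff 0 := by
  intro heq
  have h2 := fabc_coeff_succ p (show m ≤ 2 * m by lia) 0
  have h3 := fabc_coeff_succ p (show m ≤ 3 * m by lia) 0
  have c2 := fabc_eval_zero_ne_zero (p := p) (show m ≤ 2 * m by lia) (by lia)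
  have c3 := fabc_eval_zero_ne_zero (p := p) (show m ≤ 3 * m by lia) (by lia)
  rw [← coeff_zero_eq_eval_zero] at c2 c3
  have hm0 : (m : ZMod p) ≠ 0 := by
    rw [Ne, ZMod.natCast_eq_zero_iff]
    intro hd
    have hpos : 0 < m := by
      rcases Nat.eq_zero_or_pos m with rfl | hm
      · exact absurd (hpm ▸ hp.out) (by norm_num)
      · exact hm
    exact absurd (Nat.le_of_dvd hpos hd) (by lia)
  push_cast at h2 h3
  have key : (fabc p (2 * m) (2 * m) m).coeff 0 * (fabc p (3 * m) (3 * m) m).coeff 0 *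
      (m : ZMod p) ^ 2 * (m - 1) = 0 := by
    linear_combination (-(1 + (m : ZMod p)) * (1 + 2 * m)) * heq +
      (1 + (m : ZMod p)) * (fabc p (2 * m) (2 * m) m).coeff 0 * h3 -
      (1 + 2 * (m : ZMod p)) * (fabc p (3 * m) (3 * m) m).coeff 0 * h2
  have hm1 : (m : ZMod p) = 1 := by
    simpa [c2, c3, hm0, sub_eq_zero] using key
  have hp8 : p ∣ 8 := by
    rw [← ZMod.natCast_eq_zero_iff]
    have := (ZMod.natCast_eq_zero_iff (7 * m + 1) p).mpr (dvd_of_eq hpm)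
    push_cast at this ⊢
    linear_combination this - 7 * hm1
  have : p ∣ 2 := hp.out.dvd_of_dvd_pow (n := 3) (by simpa using hp8)
  have := Nat.le_of_dvd (by lia) this
  have := hp.out.two_le
  lia

/-- The `p ≡ 1 (mod 7)` case of Lemma `p equiv mo`: for a prime `p ≡ 1 (mod 7)`,
with `φ₂ = f((2p-2)/7, (2p-2)/7, (p-1)/7)` and `φ₃ = f((3p-3)/7, (3p-3)/7, (5p-5)/7)`,
there is `α ∈ F̄_p ∖ {0,1}` with `φ₂(α) = 0 ≠ φ₃(α)`, and `β ∈ F̄_p ∖ {0,1}` with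
`φ₃(β) = 0 ≠ φ₂(β)`. -/
theorem stmt_17 (p : ℕ) [Fact p.Prime] (hmod : p % 7 = 1) :
    (∃ α : AlgebraicClosure (ZMod p), α ≠ 0 ∧ α ≠ 1 ∧
      Polynomial.aeval α (fabc p ((2 * p - 2) / 7) ((2 * p - 2) / 7) ((p - 1) / 7)) = 0 ∧
      Polynomial.aeval α (fabc p ((3 * p - 3) / 7) ((3 * p - 3) / 7) ((5 * p - 5) / 7)) ≠ 0) ∧
    (∃ β : AlgebraicClosure (ZMod p), β ≠ 0 ∧ β ≠ 1 ∧
      Polynomial.aeval β (fabc p ((3 * p - 3) / 7) ((3 * p - 3) / 7) ((5 * p - 5) / 7)) = 0 ∧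
      Polynomial.aeval β (fabc p ((2 * p - 2) / 7) ((2 * p - 2) / 7) ((p - 1) / 7)) ≠ 0) := by
  obtain ⟨m, rfl⟩ : ∃ m, p = 7 * m + 1 := ⟨p / 7, by lia⟩
  rw [show (2 * (7 * m + 1) - 2) / 7 = 2 * m by lia, show (7 * m + 1 - 1) / 7 = m by lia,
    show (3 * (7 * m + 1) - 3) / 7 = 3 * m by lia,
    show (5 * (7 * m + 1) - 5) / 7 = 2 * (3 * m) - m by lia, fabc_reflect _ _ _ (by lia)]
  have hne := fabc_two_three_not_proportional (m := m) rfl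
  have hne' := hne.symm
  rw [mul_comm (coeff (fabc _ (2 * m) _ _) 1), mul_comm (coeff (fabc _ (2 * m) _ _) 0)] at hne'
  constructor
  · obtain ⟨a, h0, h1, h2, h3⟩ := exists_aeval_fabc_eq_zero_and_ne_zero
      (AlgebraicClosure (ZMod (7 * m + 1))) (show m ≤ 2 * m by lia) (show m ≤ 3 * m by lia)
      (by lia) (by lia) hne
    refine ⟨a, h0, h1, h2, ?_⟩
    rw [map_mul, map_pow, aeval_X]
    exact mul_ne_zero (pow_ne_zero _ h0) h3
  · obtain ⟨b, h0, h1, h2, h3⟩ := exists_aeval_fabc_eq_zero_and_ne_zero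
      (AlgebraicClosure (ZMod (7 * m + 1))) (show m ≤ 3 * m by lia) (show m ≤ 2 * m by lia)
      (by lia) (by lia) hne'
    refine ⟨b, h0, h1, ?_, h3⟩
    rw [map_mul, h2, mul_zero]
end
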